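/- Consider a two-player extensive-form game (as in the model below) satisfying perfect recall, in which chance is public. Then the game is triangle-free. -/

import Mathlib

open scoped Classical

/-- The type of "sequences" of a player: `none` is the empty sequence `∅`, and
`some (I, a)` is the sequence consisting of information set `I` (a set of nodes)
together with action `a` at `I`. -/
abbrev SeqP := Option (Set (List ℕ) × ℕ)

/-- The type of (candidate) reduced-normal-form plans: partial functions from
information sets to actions, encoded with `Option`. -/
abbrev PlanT := Set (List ℕ) → Option ℕ

/-- Two information sets (of the two players) are connected, `I ⇌ J`, if some node
of one is a prefix of some node of the other. -/
def Connected (I J : Set (List ℕ)) : Prop := ∃ u ∈ I, ∃ v ∈ J, u <+: v ∨ v <+: u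

/-- A two-player extensive-form game.  Nodes are histories (finite lists of naturals),
`H` is the finite, prefix-closed set of nodes.  The two players are `0` and `1`
(as elements of `Fin 2`, embedded into `Fin 3` via `Fin.castSucc`), and an internal
node `u` with `owner u = 2` is a chance node.  `sim i` is the information-partition
equivalence relation of player `i` on the internal nodes owned by player `i`. -/
structure EFG where
  H : Finset (List ℕ)
  root_mem : ([] : List ℕ) ∈ H
  prefix_closed : ∀ u v : List ℕ, u <+: v → v ∈ H → u ∈ H
  owner : List ℕ → Fin 3
  sim : Fin 2 → List ℕ → List ℕ → Prop
  sim_mem : ∀ i u v, sim i u v → (∃ a, u ++ [a] ∈ H) ∧ owner u = Fin.castSucc i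
  sim_refl : ∀ i u, (∃ a, u ++ [a] ∈ H) → owner u = Fin.castSucc i → sim i u u
  sim_symm : ∀ i u v, sim i u v → sim i v u
  sim_trans : ∀ i u v w, sim i u v → sim i v w → sim i u w
  sim_actions : ∀ i u v, sim i u v → ∀ a : ℕ, u ++ [a] ∈ H ↔ v ++ [a] ∈ H

namespace EFG

variable (G : EFG)

/-- A node is internal if it has at least one child in the tree. -/
def Internal (u : List ℕ) : Prop := ∃ a, u ++ [a] ∈ G.H

/-- The (finite) set of actions `A(u) = {a : u ++ [a] ∈ H}` available at node `u`. -/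
noncomputable def actions (u : List ℕ) : Finset ℕ :=
  (G.H.finite_toSet.preimage (f := fun a : ℕ => u ++ [a])
    (fun a _ b _ hab => by simpa using hab)).toFinset

/-- `I` is an information set of player `i`: an equivalence class of `sim i`. -/
def InfoSet (i : Fin 2) (I : Set (List ℕ)) : Prop :=
  ∃ u, G.sim i u u ∧ I = {v | G.sim i u v}

/-- `seqᵢ(u)`: the list (ordered by increasing length of the prefix `w`) of pairs
`(I, a)` such that `w ++ [a] ≼ u` for some internal node `w` owned by player `i`
whose information set is `I`. -/
noncomputable def playerSeq (i : Fin 2) (u : List ℕ) : List (Set (List ℕ) × ℕ) :=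
  (List.range u.length).filterMap fun k =>
    if G.Internal (u.take k) ∧ G.owner (u.take k) = Fin.castSucc i then
      some ({v | G.sim i (u.take k) v}, u.getD k 0)
    else none

/-- Perfect recall: nodes in the same information set have the same player sequence. -/
def PerfectRecall : Prop := ∀ i u v, G.sim i u v → G.playerSeq i u = G.playerSeq i v

/-- The parent sequence `σ(I)` of an information set `I` of player `i`: the last
element of `seqᵢ(u)` for `u ∈ I` (`none` encodes the empty sequence `∅`). -/
noncomputable def parentSeq (i : Fin 2) (I : Set (List ℕ)) : SeqP :=
  if h : ∃ u, u ∈ I then (G.playerSeq i h.choose).getLast? else none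

/-- All chance moves are public: any two nodes in the same information set have
the same set of chance moves (pairs of a chance node and an action) on their paths. -/
def PublicChance : Prop :=
  ∀ i u v, G.sim i u v →
    {p : List ℕ × ℕ | G.Internal p.1 ∧ G.owner p.1 = 2 ∧ p.1 ++ [p.2] <+: u} =
    {p : List ℕ × ℕ | G.Internal p.1 ∧ G.owner p.1 = 2 ∧ p.1 ++ [p.2] <+: v}

/-- Triangle-freeness of the game. -/
def TriangleFree : Prop :=
  ¬ ∃ I₁ I₂ J₁ J₂ : Set (List ℕ),
      G.InfoSet 0 I₁ ∧ G.InfoSet 0 I₂ ∧ G.InfoSet 1 J₁ ∧ G.InfoSet 1 J₂ ∧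
      I₁ ≠ I₂ ∧ J₁ ≠ J₂ ∧
      G.parentSeq 0 I₁ = G.parentSeq 0 I₂ ∧ G.parentSeq 1 J₁ = G.parentSeq 1 J₂ ∧
      Connected I₁ J₁ ∧ Connected I₂ J₂ ∧ Connected I₁ J₂

/-- `σ` is a member of `Σᵢ`, the set of sequences of player `i`. -/
def IsSeq (i : Fin 2) (σ : SeqP) : Prop :=
  σ = none ∨ ∃ I a, σ = some (I, a) ∧ G.InfoSet i I ∧ ∃ u ∈ I, u ++ [a] ∈ G.H

/-- `(σ₁, σ₂)` is a relevant sequence pair, `σ₁ ⇌ σ₂`. -/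
def RelPair (σ₁ σ₂ : SeqP) : Prop :=
  G.IsSeq 0 σ₁ ∧ G.IsSeq 1 σ₂ ∧
    (σ₁ = none ∨ σ₂ = none ∨
      ∃ I₁ a₁ I₂ a₂, σ₁ = some (I₁, a₁) ∧ σ₂ = some (I₂, a₂) ∧ Connected I₁ I₂)

/-- `σ₂ ∈ Σ₂` is relevant for the player-1 information set `I₁`. -/
def RelFor₁ (σ₂ : SeqP) (I₁ : Set (List ℕ)) : Prop :=
  σ₂ = none ∨ ∃ I₂ a₂, σ₂ = some (I₂, a₂) ∧ Connected I₁ I₂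

/-- `σ₁ ∈ Σ₁` is relevant for the player-2 information set `I₂`. -/
def RelFor₂ (σ₁ : SeqP) (I₂ : Set (List ℕ)) : Prop :=
  σ₁ = none ∨ ∃ I₁ a₁, σ₁ = some (I₁, a₁) ∧ Connected I₁ I₂

/-- The index set of correlation plans: the relevant sequence pairs `Σ₁ ⇌ Σ₂`. -/
abbrev Idx := {p : SeqP × SeqP // G.RelPair p.1 p.2}

/-- The entry of a vector `v` indexed by relevant pairs at the pair `(σ₁, σ₂)`
(and `0` at irrelevant pairs, which never occur in the constraints below). -/
noncomputable def val (v : G.Idx → ℝ) (σ₁ σ₂ : SeqP) : ℝ :=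
  if h : G.RelPair σ₁ σ₂ then v ⟨(σ₁, σ₂), h⟩ else 0

/-- The von Stengel–Forges polytope `𝒱`. -/
def VSF : Set (G.Idx → ℝ) :=
  {v | (∀ p, 0 ≤ v p) ∧
    G.val v none none = 1 ∧
    (∀ I₁, G.InfoSet 0 I₁ → ∀ σ₂, G.IsSeq 1 σ₂ → RelFor₁ σ₂ I₁ → ∀ u ∈ I₁,
      ∑ a ∈ G.actions u, G.val v (some (I₁, a)) σ₂ = G.val v (G.parentSeq 0 I₁) σ₂) ∧
    (∀ I₂, G.InfoSet 1 I₂ → ∀ σ₁, G.IsSeq 0 σ₁ → RelFor₂ σ₁ I₂ → ∀ u ∈ I₂,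
      ∑ a ∈ G.actions u, G.val v σ₁ (some (I₂, a)) = G.val v σ₁ (G.parentSeq 1 I₂))}

/-- `π` is a reduced-normal-form plan for player `i`. -/
def IsPlan (i : Fin 2) (π : PlanT) : Prop :=
  (∀ I, ¬ G.InfoSet i I → π I = none) ∧
  (∀ I, G.InfoSet i I →
    ((π I).isSome = true ↔ ∀ u ∈ I, ∀ p ∈ G.playerSeq i u, π p.1 = some p.2)) ∧
  (∀ I a, G.InfoSet i I → π I = some a → ∃ u ∈ I, u ++ [a] ∈ G.H)

/-- `Πᵢ(σ)`: the set of reduced-normal-form plans of player `i` compatible with `σ`. -/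
def PlanSet (i : Fin 2) : SeqP → Set PlanT
  | none => {π | G.IsPlan i π}
  | some (I, a) => {π | G.IsPlan i π ∧ π I = some a}

/-- `μ` is a probability distribution on `Π₁ × Π₂`. -/
def IsDist (μ : PlanT × PlanT → ℝ) : Prop :=
  (∀ q, 0 ≤ μ q) ∧ (Function.support μ).Finite ∧
  (∀ q, μ q ≠ 0 → G.IsPlan 0 q.1 ∧ G.IsPlan 1 q.2) ∧
  ∑ᶠ q, μ q = 1

/-- The linear map `f` from distributions on `Π₁ × Π₂` to correlation plans. -/
noncomputable def corrMap (μ : PlanT × PlanT → ℝ) : G.Idx → ℝ :=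
  fun p => ∑ᶠ q ∈ {q : PlanT × PlanT | q.1 ∈ G.PlanSet 0 p.1.1 ∧ q.2 ∈ G.PlanSet 1 p.1.2}, μ q

/-- The polytope of correlation plans `Ξ`: the image of the probability distributions
on `Π₁ × Π₂` under `f`. -/
def corrPoly : Set (G.Idx → ℝ) := {x | ∃ μ, G.IsDist μ ∧ x = G.corrMap μ}

/-- The `σ₁`-rank of a player-2 information set `I₂`: the number of player-1
information sets connected to `I₂` whose parent sequence is `σ₁`. -/
noncomputable def rank₁ (σ₁ : SeqP) (I₂ : Set (List ℕ)) : ℕ :=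
  Nat.card {J : Set (List ℕ) // G.InfoSet 0 J ∧ Connected J I₂ ∧ G.parentSeq 0 J = σ₁}

/-- The `σ₂`-rank of a player-1 information set `I₁`: the number of player-2
information sets connected to `I₁` whose parent sequence is `σ₂`. -/
noncomputable def rank₂ (σ₂ : SeqP) (I₁ : Set (List ℕ)) : ℕ :=
  Nat.card {J : Set (List ℕ) // G.InfoSet 1 J ∧ Connected I₁ J ∧ G.parentSeq 1 J = σ₂}

end EFG

/-- The point-mass distribution `𝟙_{q₀}` on pairs of plans. -/
noncomputable def pointMass (q₀ : PlanT × PlanT) : PlanT × PlanT → ℝ :=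
  fun q => if q = q₀ then 1 else 0

theorem List.prefix_or_prefix_or_diverge {α : Type*} (p q : List α) :
    p <+: q ∨ q <+: p ∨ ∃ z a b, a ≠ b ∧ z ++ [a] <+: p ∧ z ++ [b] <+: q := by
  induction p generalizing q with
  | nil => exact .inl q.nil_prefix
  | cons x p ih =>
    cases q with
    | nil => exact .inr (.inl (List.nil_prefix))
    | cons y q =>
      by_cases hxy : x = y
      · subst hxy
        rcases ih q with h | h | ⟨z, a, b, hab, hp, hq⟩
        · exact .inl (by simpa using h)
        · exact .inr (.inl (by simpa using h))
        · exact .inr (.inr ⟨x :: z, a, b, hab, by simpa using hp, by simpa using hq⟩)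
      · exact .inr (.inr ⟨[], x, y, hxy, by simp, by simp⟩)

theorem List.prefix_or_concat_prefix {α : Type*} {x y z : List α} {b : α}
    (hy : y <+: x ∨ x <+: y) (hz : z ++ [b] <+: x) : y <+: z ∨ z ++ [b] <+: y := by
  rcases hy with hy | hy
  · rcases List.prefix_or_prefix_of_prefix hy hz with h | h
    · rcases List.prefix_concat_iff.1 h with rfl | h
      · exact .inr (List.prefix_refl _)
      · exact .inl h
    · exact .inr h
  · exact .inr (hz.trans hy)

theorem List.eq_of_concat_prefix {α : Type*} {z z' p q : List α} {a b a' b' : α}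
    (hab : a ≠ b) (hab' : a' ≠ b') (hp : z ++ [a] <+: p) (hq : z ++ [b] <+: q)
    (hp' : z' ++ [a'] <+: p) (hq' : z' ++ [b'] <+: q) : z = z' := by
  have key : ∀ {z z' : List α} {a b a' : α}, a ≠ b → z ++ [a] <+: p → z ++ [b] <+: q →
      z' ++ [a'] <+: p → z' <+: q → z' <+: z := by
    intro z z' a b a' hab hp hq hp' hq'
    rcases List.prefix_or_concat_prefix (.inl hq') hq with h | h
    · exact h
    · have ha := hp
      have hb := h.trans ((List.prefix_append z' [a']).trans hp')
      have := (List.prefix_of_prefix_length_le ha hb (by simp)).eq_of_length (by simp)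
      exact absurd (by simpa using this) hab
  have h₁ := key hab hp hq hp' ((List.prefix_append z' [b']).trans hq')
  have h₂ := key hab' hp' hq' hp ((List.prefix_append z [b]).trans hq)
  exact h₂.eq_of_length_le h₁.length_le

theorem Connected.symm {I J : Set (List ℕ)} (h : Connected I J) : Connected J I := by
  obtain ⟨u, hu, v, hv, h⟩ := h
  exact ⟨v, hv, u, hu, h.symm⟩

namespace EFG

variable {G : EFG}

theorem sim_left {i : Fin 2} {u v : List ℕ} (h : G.sim i u v) : G.sim i u u :=
  G.sim_trans i _ _ _ h (G.sim_symm i _ _ h)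

theorem Internal.mem {u : List ℕ} (h : G.Internal u) : u ∈ G.H := by
  obtain ⟨a, ha⟩ := h
  exact G.prefix_closed _ _ (List.prefix_append u [a]) ha

theorem Internal.of_concat_prefix {z p : List ℕ} {a : ℕ} (hp : G.Internal p)
    (h : z ++ [a] <+: p) : G.Internal z :=
  ⟨a, G.prefix_closed _ _ h hp.mem⟩

theorem InfoSet.sim_of_mem {i : Fin 2} {I : Set (List ℕ)} (hI : G.InfoSet i I)
    {u v : List ℕ} (hu : u ∈ I) (hv : v ∈ I) : G.sim i u v := by
  obtain ⟨w, -, rfl⟩ := hI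
  exact G.sim_trans i _ _ _ (G.sim_symm i _ _ hu) hv

theorem InfoSet.eq_setOf_sim {i : Fin 2} {I : Set (List ℕ)} (hI : G.InfoSet i I)
    {u : List ℕ} (hu : u ∈ I) : I = {v | G.sim i u v} := by
  obtain ⟨w, -, rfl⟩ := hI
  ext v
  exact ⟨fun hv => G.sim_trans i _ _ _ (G.sim_symm i _ _ hu) hv,
    fun hv => G.sim_trans i _ _ _ hu hv⟩

theorem playerSeq_concat (i : Fin 2) (u : List ℕ) (a : ℕ) :
    G.playerSeq i (u ++ [a]) = G.playerSeq i u ++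
      if G.Internal u ∧ G.owner u = Fin.castSucc i then [({v | G.sim i u v}, a)] else [] := by
  unfold playerSeq
  rw [List.length_append, List.length_singleton, List.range_succ, List.filterMap_append]
  congr 1
  · apply List.filterMap_congr
    intro k hk
    have hk : k < u.length := List.mem_range.1 hk
    rw [List.take_append_of_le_length hk.le, List.getD_append _ _ _ _ hk]
  · by_cases h : G.Internal u ∧ G.owner u = Fin.castSucc i <;> simp [h]

theorem playerSeq_prefix (i : Fin 2) {u v : List ℕ} (h : u <+: v) :
    G.playerSeq i u <+: G.playerSeq i v := by
  obtain ⟨t, rfl⟩ := h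
  induction t using List.reverseRecOn with
  | nil => simp
  | append_singleton t a ih =>
    rw [← List.append_assoc, playerSeq_concat]
    exact ih.trans (List.prefix_append _ _)

theorem playerSeq_concat_prefix {i : Fin 2} {z p : List ℕ} {a : ℕ} (hz : G.Internal z)
    (ho : G.owner z = Fin.castSucc i) (h : z ++ [a] <+: p) :
    G.playerSeq i z ++ [({v | G.sim i z v}, a)] <+: G.playerSeq i p := by
  have := playerSeq_prefix (G := G) i h
  rwa [playerSeq_concat, if_pos ⟨hz, ho⟩] at this

theorem action_eq_of_playerSeq_eq {i : Fin 2} {z p q : List ℕ} {a b : ℕ} (hz : G.Internal z)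
    (ho : G.owner z = Fin.castSucc i) (hpq : G.playerSeq i p = G.playerSeq i q)
    (hp : z ++ [a] <+: p) (hq : z ++ [b] <+: q) : a = b := by
  have h₁ := playerSeq_concat_prefix hz ho hp
  have h₂ := playerSeq_concat_prefix hz ho hq
  rw [hpq] at h₁
  have := (List.prefix_of_prefix_length_le h₁ h₂ (by simp)).eq_of_length (by simp)
  simpa using this

theorem eq_of_prefix_of_playerSeq_eq {i : Fin 2} {p q : List ℕ} (hp : G.Internal p)
    (ho : G.owner p = Fin.castSucc i) (hpq : G.playerSeq i p = G.playerSeq i q)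
    (h : p <+: q) : p = q := by
  obtain ⟨_ | ⟨a, t⟩, rfl⟩ := h
  · simp
  · have := (playerSeq_concat_prefix hp ho (p := p ++ a :: t) (a := a) ⟨t, by simp⟩).length_le
    rw [← hpq] at this
    simp at this

/-- Distinct decision nodes of a player with the same player sequence branch off at a node
that the player does not own. -/
theorem exists_diverge_of_playerSeq_eq {i : Fin 2} {p q : List ℕ} (hp : G.sim i p p)
    (hq : G.sim i q q) (hpq : G.playerSeq i p = G.playerSeq i q) (hne : p ≠ q) :
    ∃ z a b, a ≠ b ∧ z ++ [a] <+: p ∧ z ++ [b] <+: q ∧ G.owner z ≠ Fin.castSucc i := by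
  have hp' := G.sim_mem i _ _ hp
  have hq' := G.sim_mem i _ _ hq
  rcases List.prefix_or_prefix_or_diverge p q with h | h | ⟨z, a, b, hab, ha, hb⟩
  · exact absurd (eq_of_prefix_of_playerSeq_eq hp'.1 hp'.2 hpq h) hne
  · exact absurd (eq_of_prefix_of_playerSeq_eq hq'.1 hq'.2 hpq.symm h).symm hne
  · exact ⟨z, a, b, hab, ha, hb, fun ho => hab <|
      action_eq_of_playerSeq_eq (Internal.of_concat_prefix hp'.1 ha) ho hpq ha hb⟩

theorem exists_playerSeq_eq_concat {i : Fin 2} {v : List ℕ} {x : Set (List ℕ) × ℕ}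
    (h : (G.playerSeq i v).getLast? = some x) :
    ∃ w, G.sim i w w ∧ x.1 = {v | G.sim i w v} ∧ G.playerSeq i v = G.playerSeq i w ++ [x] := by
  induction v using List.reverseRecOn with
  | nil => simp [playerSeq] at h
  | append_singleton v a ih =>
    rw [playerSeq_concat] at h ⊢
    split_ifs at h ⊢ with hv
    · obtain rfl : _ = x := by simpa using h
      exact ⟨v, G.sim_refl i v hv.1 hv.2, rfl, rfl⟩
    · rw [List.append_nil] at h ⊢
      exact ih h

theorem PerfectRecall.parentSeq_eq (hpr : G.PerfectRecall) {i : Fin 2} {I : Set (List ℕ)}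
    (hI : G.InfoSet i I) {u : List ℕ} (hu : u ∈ I) :
    G.parentSeq i I = (G.playerSeq i u).getLast? := by
  have h : ∃ u, u ∈ I := ⟨u, hu⟩
  rw [parentSeq, dif_pos h, hpr i _ _ (hI.sim_of_mem h.choose_spec hu)]

/-- Under perfect recall, the parent sequence determines the whole player sequence. -/
theorem PerfectRecall.playerSeq_eq (hpr : G.PerfectRecall) {i : Fin 2} {I J : Set (List ℕ)}
    (hI : G.InfoSet i I) (hJ : G.InfoSet i J) (hIJ : G.parentSeq i I = G.parentSeq i J)
    {u v : List ℕ} (hu : u ∈ I) (hv : v ∈ J) : G.playerSeq i u = G.playerSeq i v := by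
  rw [hpr.parentSeq_eq hI hu, hpr.parentSeq_eq hJ hv] at hIJ
  cases hx : (G.playerSeq i u).getLast? with
  | none =>
    rw [hx] at hIJ
    rw [List.getLast?_eq_none_iff.1 hx, List.getLast?_eq_none_iff.1 hIJ.symm]
  | some x =>
    rw [hx] at hIJ
    obtain ⟨w, hw, hxw, hu⟩ := exists_playerSeq_eq_concat hx
    obtain ⟨w', hw', hxw', hv⟩ := exists_playerSeq_eq_concat hIJ.symm
    have hww' : w ∈ {v | G.sim i w' v} := by
      rw [← hxw', hxw]
      exact hw
    rw [hu, hv, hpr i _ _ hww']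

theorem PublicChance.action_eq (hpc : G.PublicChance) {i : Fin 2} {p q z : List ℕ} {a b : ℕ}
    (h : G.sim i p q) (ho : G.owner z = 2) (hp : z ++ [a] <+: p) (hq : z ++ [b] <+: q) :
    a = b := by
  have hz : G.Internal z := Internal.of_concat_prefix (G.sim_mem i _ _ h).1 hp
  have haq : z ++ [a] <+: q := ((Set.ext_iff.1 (hpc i p q h) (z, a)).1 ⟨hz, ho, hp⟩).2.2
  have := (List.prefix_of_prefix_length_le haq hq (by simp)).eq_of_length (by simp)
  simpa using this

/-- With public chance, distinct nodes of an information set branch off at a node of the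
opponent. -/
theorem exists_diverge_of_sim (hpr : G.PerfectRecall) (hpc : G.PublicChance) {i j : Fin 2}
    (hij : i ≠ j) {p q : List ℕ} (h : G.sim i p q) (hne : p ≠ q) :
    ∃ z a b, a ≠ b ∧ z ++ [a] <+: p ∧ z ++ [b] <+: q ∧ G.owner z = Fin.castSucc j := by
  obtain ⟨z, a, b, hab, ha, hb, ho⟩ := exists_diverge_of_playerSeq_eq (sim_left h)
    (sim_left (G.sim_symm i _ _ h)) (hpr i _ _ h) hne
  have ho₂ : G.owner z ≠ 2 := fun ho₂ => hab (hpc.action_eq h ho₂ ha hb)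
  refine ⟨z, a, b, hab, ha, hb, ?_⟩
  generalize G.owner z = o at ho ho₂
  clear h
  revert i j o
  decide

/-- An information set connected to two distinct sibling information sets of the opponent
precedes each of them somewhere. -/
theorem exists_prefix_of_connected (hpr : G.PerfectRecall) (hpc : G.PublicChance) {i j : Fin 2}
    (hij : i ≠ j) {I J₁ J₂ : Set (List ℕ)} (hI : G.InfoSet i I) (hJ₁ : G.InfoSet j J₁)
    (hJ₂ : G.InfoSet j J₂) (hne : J₁ ≠ J₂) (hσ : G.parentSeq j J₁ = G.parentSeq j J₂)
    (h₁ : Connected I J₁) (h₂ : Connected I J₂) : ∃ u ∈ I, ∃ v ∈ J₂, u <+: v := by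
  obtain ⟨u, hu, v, hv, huv⟩ := h₁
  obtain ⟨u', hu', v', hv', huv'⟩ := h₂
  have hvv' : v ≠ v' := by
    rintro rfl
    exact hne ((hJ₁.eq_setOf_sim hv).trans (hJ₂.eq_setOf_sim hv').symm)
  obtain ⟨z, a, b, hab, ha, hb, ho⟩ := exists_diverge_of_playerSeq_eq (hJ₁.sim_of_mem hv hv)
    (hJ₂.sim_of_mem hv' hv') (hpr.playerSeq_eq hJ₁ hJ₂ hσ hv hv') hvv'
  have hz : z <+: v' := (List.prefix_append z [b]).trans hb
  rcases List.prefix_or_concat_prefix huv ha with h | hau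
  · exact ⟨u, hu, v', hv', h.trans hz⟩
  rcases List.prefix_or_concat_prefix huv' hb with h | hbu
  · exact ⟨u', hu', v', hv', h.trans hz⟩
  have huu' : u ≠ u' := by
    rintro rfl
    have := (List.prefix_of_prefix_length_le hau hbu (by simp)).eq_of_length (by simp)
    exact hab (by simpa using this)
  obtain ⟨z', a', b', hab', ha', hb', hoz⟩ :=
    exists_diverge_of_sim hpr hpc hij (hI.sim_of_mem hu hu') huu'
  rw [List.eq_of_concat_prefix hab hab' hau hbu ha' hb'] at ho
  exact absurd hoz ho

/-- With public chance, two information sets of different players cannot precede each other. -/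
theorem not_prefix_and_prefix (hpr : G.PerfectRecall) (hpc : G.PublicChance) {i j : Fin 2}
    (hij : i ≠ j) {u x v y : List ℕ} (hux : G.sim i u x) (hvy : G.sim j v y) (huv : u <+: v)
    (hyx : y <+: x) : False := by
  have hy := G.sim_mem j _ _ (G.sim_symm j _ _ hvy)
  have hseq := hpr j _ _ hvy
  by_cases hne : u = x
  · subst hne
    obtain rfl := eq_of_prefix_of_playerSeq_eq hy.1 hy.2 hseq.symm (hyx.trans huv)
    obtain rfl := huv.eq_of_length_le hyx.length_le
    exact hij (Fin.castSucc_injective 2 ((G.sim_mem i _ _ hux).2.symm.trans hy.2))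
  · obtain ⟨z, a, b, hab, ha, hb, ho⟩ := exists_diverge_of_sim hpr hpc hij hux hne
    rcases List.prefix_or_concat_prefix (.inl hyx) hb with h | h
    · have hzv := ha.trans huv
      obtain rfl := eq_of_prefix_of_playerSeq_eq hy.1 hy.2 hseq.symm
        (h.trans ((List.prefix_append z [a]).trans hzv))
      simpa using hzv.length_le.trans h.length_le
    · exact hab (action_eq_of_playerSeq_eq (Internal.of_concat_prefix hy.1 h) ho hseq
        (ha.trans huv) h)

end EFG

/-- A two-player extensive-form game with perfect recall in which
all chance moves are public is triangle-free. -/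
theorem publicChance_triangleFree (G : EFG) (hpr : G.PerfectRecall)
    (hpc : G.PublicChance) : G.TriangleFree := by
  rintro ⟨I₁, I₂, J₁, J₂, hI₁, hI₂, hJ₁, hJ₂, hI, hJ, hσI, hσJ, h₁₁, h₂₂, h₁₂⟩
  obtain ⟨u, hu, v, hv, huv⟩ := EFG.exists_prefix_of_connected hpr hpc zero_ne_one hI₁ hJ₁ hJ₂
    hJ hσJ h₁₁ h₁₂
  obtain ⟨y, hy, x, hx, hyx⟩ := EFG.exists_prefix_of_connected hpr hpc one_ne_zero hJ₂ hI₂ hI₁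
    hI.symm hσI.symm h₂₂.symm h₁₂.symm
  exact EFG.not_prefix_and_prefix hpr hpc zero_ne_one (hI₁.sim_of_mem hu hx)
    (hJ₂.sim_of_mem hv hy) huv hyx
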